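/- Let N ≥ 2, let θ = 1/N, and let Φ: D^N → D^N be defined by Φ(z₁, …, z_N) = (λ_{1/N}(z₁), λ_{1/N}(z₁), …, λ_{1/N}(z₁)). Then the composition operator C_Φ: H²(D^N) → H²(D^N) is bounded but not compact. -/

import Mathlib

open Complex MeasureTheory Set Filter
open scoped ENNReal Topology

noncomputable section

/-- The open unit disk in `ℂ`. -/
def unitDisk : Set ℂ := Metric.ball (0 : ℂ) 1

/-- A symbol: a non-constant analytic self-map of the unit disk. -/
structure IsSymbol (φ : ℂ → ℂ) : Prop where
  mapsTo : Set.MapsTo φ unitDisk unitDisk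
  diff : DifferentiableOn ℂ φ unitDisk
  nonconst : ¬ ∃ c : ℂ, Set.EqOn φ (fun _ => c) unitDisk

/-- `φ` is `p`-valent: every `w ∈ 𝔻` has at most `p` preimages in `𝔻`. -/
def Valent (φ : ℂ → ℂ) (p : ℕ) : Prop :=
  ∀ w ∈ unitDisk, (unitDisk ∩ φ ⁻¹' {w}).encard ≤ p

/-- The radial limit of `φ` at the boundary point `toCircle θ` exists and equals `w`.
The circle `𝕋` is parametrized by `AddCircle 1` (so that `volume` is the normalized
Haar measure `m`). -/
def HasRadialLimit (φ : ℂ → ℂ) (θ : AddCircle (1 : ℝ)) (w : ℂ) : Prop :=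
  Filter.Tendsto (fun r : ℝ => φ (r * (AddCircle.toCircle θ : ℂ)))
    (nhdsWithin 1 (Set.Iio 1)) (nhds w)

/-- The pull-back measure `m_φ(S) = m({ξ : φ*(ξ) ∈ S})`. -/
def pullbackMeasure (φ : ℂ → ℂ) (S : Set ℂ) : ℝ≥0∞ :=
  volume {θ : AddCircle (1 : ℝ) | ∃ w ∈ S, HasRadialLimit φ θ w}

/-- `ρ_φ(h) = sup_{ξ ∈ 𝕋} m_φ[S(ξ,h)]`, where `S(ξ,h) = {z : |z - ξ| ≤ h}`. -/
def rho (φ : ℂ → ℂ) (h : ℝ) : ℝ≥0∞ :=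
  ⨆ ξ : Circle, pullbackMeasure φ {z : ℂ | ‖z - (ξ : ℂ)‖ ≤ h}

/-- The `n`-th approximation number of a bounded operator between normed spaces:
the distance of `T` to operators of rank `< n`. -/
def approxNum {E F : Type*} [NormedAddCommGroup E] [NormedAddCommGroup F]
    [NormedSpace ℂ E] [NormedSpace ℂ F] (n : ℕ) (T : E →L[ℂ] F) : ℝ :=
  sInf {c : ℝ | ∃ R : E →L[ℂ] F,
    Module.rank ℂ (LinearMap.range (R : E →ₗ[ℂ] F)) < (n : Cardinal) ∧ c = ‖T - R‖}

/-- The Hardy space `H²(𝔻)` in its coefficient model `ℓ²(ℕ)`. -/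
abbrev H2 := lp (fun _ : ℕ => ℂ) 2

/-- The analytic function on `𝔻` associated with an element of `H²`. -/
def H2.eval (a : H2) (z : ℂ) : ℂ := ∑' n : ℕ, a n * z ^ n

/-- `T` is the composition operator with symbol `φ` on `H²(𝔻)`. -/
def IsCompOp (φ : ℂ → ℂ) (T : H2 →L[ℂ] H2) : Prop :=
  ∀ a : H2, ∀ z ∈ unitDisk, H2.eval (T a) z = H2.eval a (φ z)

/-- The open unit polydisk `𝔻^N`. -/
def polyDisk (N : ℕ) : Set (Fin N → ℂ) := {z | ∀ i, ‖z i‖ < 1}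

/-- The Hardy space `H²(𝔻^N)` in its coefficient model `ℓ²(ℕ^N)`. -/
abbrev H2poly (N : ℕ) := lp (fun _ : Fin N → ℕ => ℂ) 2

/-- The analytic function on `𝔻^N` associated with an element of `H²(𝔻^N)`. -/
def H2poly.eval {N : ℕ} (a : H2poly N) (z : Fin N → ℂ) : ℂ :=
  ∑' α : Fin N → ℕ, a α * ∏ i, z i ^ α i

/-- `T` is the composition operator with symbol `Φ` on `H²(𝔻^N)`. -/
def IsCompOpPoly {N : ℕ} (Φ : (Fin N → ℂ) → (Fin N → ℂ))
    (T : H2poly N →L[ℂ] H2poly N) : Prop :=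
  ∀ a : H2poly N, ∀ z ∈ polyDisk N, H2poly.eval (T a) z = H2poly.eval a (Φ z)

/-- The lens map `λ_θ`. -/
def lens (θ : ℝ) (z : ℂ) : ℂ :=
  ((1 + z) ^ (θ : ℂ) - (1 - z) ^ (θ : ℂ)) / ((1 + z) ^ (θ : ℂ) + (1 - z) ^ (θ : ℂ))

lemma re_cpow_mul_conj_cpow {u v : ℂ} (hu : u ≠ 0) (hv : v ≠ 0) (θ : ℝ) :
    (u ^ (θ : ℂ) * (starRingEnd ℂ) (v ^ (θ : ℂ))).re =
      (‖u‖ * ‖v‖) ^ θ * Real.cos (θ * (arg u - arg v)) := by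
  rw [cpow_def_of_ne_zero hu, cpow_def_of_ne_zero hv, ← exp_conj, ← Complex.exp_add, exp_re]
  congr 1
  · rw [Real.rpow_def_of_pos (by positivity), Real.log_mul (by positivity) (by positivity)]
    simp [log_re]
    ring
  · simp [log_im]
    ring_nf

lemma abs_arg_sub_arg_lt {z : ℂ} (hz : ‖z‖ < 1) :
    |arg (1 + z) - arg (1 - z)| < Real.pi / 2 := by
  have hre := abs_le.1 (abs_re_le_norm z)
  have hu : 0 < (1 + z).re := by simp; linarith
  have hv : 0 < (1 - z).re := by simp; linarith
  have hu0 : 1 + z ≠ 0 := fun h => by simp [h] at hu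
  have hv0 : 1 - z ≠ 0 := fun h => by simp [h] at hv
  have h1 := abs_lt.1 (abs_arg_lt_pi_div_two_iff.2 (Or.inl hu))
  have h2 := abs_lt.1 (abs_arg_lt_pi_div_two_iff.2 (Or.inl hv))
  have h3 := re_cpow_mul_conj_cpow hu0 hv0 1
  have h4 : 0 < ((1 + z) * (starRingEnd ℂ) (1 - z)).re := by
    have : ((1 + z) * (starRingEnd ℂ) (1 - z)).re = 1 - ‖z‖ ^ 2 := by
      rw [← normSq_eq_norm_sq, normSq_apply]; simp; ring
    rw [this]; nlinarith [norm_nonneg z]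
  simp only [ofReal_one, cpow_one, Real.rpow_one, one_mul] at h3
  rw [h3] at h4
  have h5 : 0 < Real.cos (arg (1 + z) - arg (1 - z)) := by
    by_contra! h
    exact absurd h4 (not_lt.2 (mul_nonpos_of_nonneg_of_nonpos (by positivity) h))
  by_contra! h
  rw [← Real.cos_abs] at h5
  have := Real.cos_nonpos_of_pi_div_two_le_of_le h
    (by rw [abs_le]; constructor <;> linarith)
  linarith

lemma half_rpow_le_re_cpow_mul_conj_cpow {θ : ℝ} (h0 : 0 < θ) (h1 : θ ≤ 1 / 2) {z : ℂ}
    (hz : ‖z‖ < 1) :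
    ‖1 - z ^ 2‖ ^ θ / 2 ≤ ((1 + z) ^ (θ : ℂ) * (starRingEnd ℂ) ((1 - z) ^ (θ : ℂ))).re := by
  have hu0 : 1 + z ≠ 0 := fun h => by
    rw [← eq_neg_iff_add_eq_zero] at h; rw [← norm_neg, ← h] at hz; simp at hz
  have hv0 : 1 - z ≠ 0 := fun h => by rw [← sub_eq_zero.1 h] at hz; simp at hz
  rw [re_cpow_mul_conj_cpow hu0 hv0, ← norm_mul, show (1 + z) * (1 - z) = 1 - z ^ 2 by ring,
    div_eq_mul_inv]
  gcongr
  have h2 : |θ * (arg (1 + z) - arg (1 - z))| ≤ Real.pi / 3 := by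
    rw [abs_mul, abs_of_pos h0]
    nlinarith [abs_arg_sub_arg_lt hz, abs_nonneg (arg (1 + z) - arg (1 - z)), Real.pi_pos]
  rw [← Real.cos_abs, inv_eq_one_div, ← Real.cos_pi_div_three]
  exact Real.cos_le_cos_of_nonneg_of_le_pi (abs_nonneg _) (by linarith [Real.pi_pos]) h2

lemma one_sub_sq_ne_zero {z : ℂ} (hz : ‖z‖ < 1) : 1 - z ^ 2 ≠ 0 := fun h => by
  have h1 : ‖z‖ ^ 2 = 1 := by rw [← norm_pow, ← sub_eq_zero.1 h, norm_one]
  nlinarith [norm_nonneg z]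

lemma cpow_add_cpow_ne_zero {θ : ℝ} (h0 : 0 < θ) (h1 : θ ≤ 1 / 2) {z : ℂ} (hz : ‖z‖ < 1) :
    (1 + z) ^ (θ : ℂ) + (1 - z) ^ (θ : ℂ) ≠ 0 := fun h => by
  have h2 := half_rpow_le_re_cpow_mul_conj_cpow h0 h1 hz
  have h3 : 0 < ‖1 - z ^ 2‖ ^ θ := Real.rpow_pos_of_pos (norm_pos_iff.2 (one_sub_sq_ne_zero hz)) _
  rw [eq_neg_of_add_eq_zero_left h, neg_mul, mul_conj, neg_re, ofReal_re] at h2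
  linarith [normSq_nonneg ((1 - z) ^ (θ : ℂ))]

lemma norm_add_cpow_le {θ : ℝ} (h0 : 0 < θ) (h1 : θ ≤ 1 / 2) {z : ℂ} (hz : ‖z‖ < 1) :
    ‖(1 + z) ^ (θ : ℂ) + (1 - z) ^ (θ : ℂ)‖ ≤ 4 := by
  have key : ∀ u : ℂ, ‖u‖ ≤ 2 → ‖u ^ (θ : ℂ)‖ ≤ 2 := fun u hu => by
    rw [norm_cpow_real]
    calc ‖u‖ ^ θ ≤ 2 ^ θ := by gcongr
      _ ≤ 2 ^ (1 : ℝ) := Real.rpow_le_rpow_of_exponent_le one_le_two (by linarith)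
      _ = 2 := Real.rpow_one 2
  refine (norm_add_le _ _).trans ?_
  have h2 := key (1 + z) ((norm_add_le _ _).trans (by rw [norm_one]; linarith))
  have h3 := key (1 - z) ((norm_sub_le _ _).trans (by rw [norm_one]; linarith))
  linarith

lemma rpow_le_one_sub_norm_lens_sq {θ : ℝ} (h0 : 0 < θ) (h1 : θ ≤ 1 / 2) {z : ℂ}
    (hz : ‖z‖ < 1) : ‖1 - z ^ 2‖ ^ θ / 8 ≤ 1 - ‖lens θ z‖ ^ 2 := by
  have h2 := half_rpow_le_re_cpow_mul_conj_cpow h0 h1 hz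
  have h3 := norm_add_cpow_le h0 h1 hz
  have h4 := norm_pos_iff.2 (cpow_add_cpow_ne_zero h0 h1 hz)
  rw [lens, norm_div, div_pow]
  generalize (1 + z) ^ (θ : ℂ) = A at *
  generalize (1 - z) ^ (θ : ℂ) = B at *
  have h5 : ‖A - B‖ ^ 2 = ‖A + B‖ ^ 2 - 4 * (A * (starRingEnd ℂ) B).re := by
    simp only [← normSq_eq_norm_sq, normSq_add, normSq_sub]; ring
  have h6 : 0 ≤ ‖1 - z ^ 2‖ ^ θ := by positivity
  rw [h5, sub_div, div_self (by positivity), sub_sub_cancel, le_div_iff₀ (by positivity)]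
  have h7 : ‖A + B‖ ^ 2 ≤ 4 ^ 2 := by gcongr
  nlinarith [mul_le_mul_of_nonneg_left h7 h6]

lemma norm_lens_lt_one {θ : ℝ} (h0 : 0 < θ) (h1 : θ ≤ 1 / 2) {z : ℂ} (hz : ‖z‖ < 1) :
    ‖lens θ z‖ < 1 := by
  have h2 := rpow_le_one_sub_norm_lens_sq h0 h1 hz
  have h3 : 0 < ‖1 - z ^ 2‖ ^ θ := Real.rpow_pos_of_pos (norm_pos_iff.2 (one_sub_sq_ne_zero hz)) _
  nlinarith [norm_nonneg (lens θ z)]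

lemma norm_lens_le_exp {θ : ℝ} (h0 : 0 < θ) (h1 : θ ≤ 1 / 2) {z : ℂ} (hz : ‖z‖ < 1) :
    ‖lens θ z‖ ≤ Real.exp (-(‖1 - z ^ 2‖ ^ θ / 16)) := by
  have h2 := rpow_le_one_sub_norm_lens_sq h0 h1 hz
  have h3 := Real.add_one_le_exp (-(‖1 - z ^ 2‖ ^ θ / 16))
  nlinarith [norm_nonneg (lens θ z), sq_nonneg (‖lens θ z‖ - 1)]

lemma differentiableOn_lens {θ : ℝ} (h0 : 0 < θ) (h1 : θ ≤ 1 / 2) :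
    DifferentiableOn ℂ (lens θ) (Metric.ball 0 1) := by
  intro z hz
  have hz' : ‖z‖ < 1 := by simpa using hz
  have hre := abs_le.1 (abs_re_le_norm z)
  have hu : 1 + z ∈ slitPlane := Or.inl (by simp; linarith)
  have hv : 1 - z ∈ slitPlane := Or.inl (by simp; linarith)
  have hA : DifferentiableAt ℂ (fun z : ℂ => (1 + z) ^ (θ : ℂ)) z :=
    (by fun_prop : DifferentiableAt ℂ (fun z : ℂ => 1 + z) z).cpow (by fun_prop) hu
  have hB : DifferentiableAt ℂ (fun z : ℂ => (1 - z) ^ (θ : ℂ)) z :=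
    (by fun_prop : DifferentiableAt ℂ (fun z : ℂ => 1 - z) z).cpow (by fun_prop) hv
  exact ((hA.sub hB).div (hA.add hB) (cpow_add_cpow_ne_zero h0 h1 hz')).differentiableWithinAt

lemma one_sub_norm_lens_sq_pow_le {N : ℕ} (hN : 2 ≤ N) {r : ℝ} (hr0 : 0 ≤ r) (hr1 : r < 1) :
    (1 - ‖lens (1 / (N : ℝ)) r‖ ^ 2) ^ N ≤ 4 ^ N * (1 - r ^ 2) := by
  have hN0 : (N : ℝ) ≠ 0 := by positivity
  have hu : (0 : ℝ) ≤ 1 + r := by linarith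
  have hv : (0 : ℝ) ≤ 1 - r := by linarith
  set a : ℝ := (1 + r) ^ (1 / (N : ℝ)) with ha
  set b : ℝ := (1 - r) ^ (1 / (N : ℝ)) with hb
  have hapos : 1 ≤ a := Real.one_le_rpow (by linarith) (by positivity)
  have hbpos : 0 ≤ b := by positivity
  have hl : lens (1 / (N : ℝ)) r = (((a - b) / (a + b) : ℝ) : ℂ) := by
    rw [lens, ha, hb]
    push_cast [ofReal_cpow hu, ofReal_cpow hv]
    rfl
  have haN : a ^ N = 1 + r := by
    rw [ha, one_div, Real.rpow_inv_natCast_pow hu (by omega)]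
  have hbN : b ^ N = 1 - r := by
    rw [hb, one_div, Real.rpow_inv_natCast_pow hv (by omega)]
  have h1 : 1 - ‖lens (1 / (N : ℝ)) r‖ ^ 2 = 4 * (a * b) / (a + b) ^ 2 := by
    rw [hl, norm_real, Real.norm_eq_abs, sq_abs]
    field_simp
    ring
  have h2 : 4 * (a * b) / (a + b) ^ 2 ≤ 4 * (a * b) :=
    div_le_self (by positivity) (one_le_pow₀ (by linarith))
  rw [h1]
  calc (4 * (a * b) / (a + b) ^ 2) ^ N ≤ (4 * (a * b)) ^ N := by gcongr
    _ = 4 ^ N * (1 - r ^ 2) := by rw [mul_pow, mul_pow, haN, hbN]; ring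

lemma hasSum_prod_pow {n : ℕ} {y : Fin n → ℂ} (hy : ∀ i, ‖y i‖ < 1) :
    Summable (fun α : Fin n → ℕ => ‖∏ i, y i ^ α i‖) ∧
      HasSum (fun α : Fin n → ℕ => ∏ i, y i ^ α i) (∏ i, (1 - y i)⁻¹) := by
  induction n with
  | zero =>
    refine ⟨(hasSum_fintype _).summable, ?_⟩
    simp
  | succ n ih =>
    obtain ⟨hs, hh⟩ := ih (y := fun i => y i.succ) fun i => hy i.succ
    have hg : Summable fun k : ℕ => ‖y 0 ^ k‖ := by
      simpa using summable_geometric_of_lt_one (norm_nonneg _) (hy 0)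
    have hmul := summable_mul_of_summable_norm hg hs
    have hcons : ∀ p : ℕ × (Fin n → ℕ),
        ∏ i, y i ^ (Fin.consEquiv (fun _ => ℕ) p) i =
          y 0 ^ p.1 * ∏ i, y (Fin.succ i) ^ p.2 i := fun p => by
      simp [Fin.prod_univ_succ, Fin.consEquiv]
    constructor
    · rw [← (Fin.consEquiv fun _ => ℕ).summable_iff]
      simpa only [Function.comp_def, hcons] using hg.mul_norm hs
    · rw [← (Fin.consEquiv fun _ => ℕ).hasSum_iff, Fin.prod_univ_succ]
      simpa only [Function.comp_def, hcons] using
        (hasSum_geometric_of_norm_lt_one (hy 0)).mul hh hmul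

lemma hasSum_norm_prod_pow_sq {n : ℕ} {z : Fin n → ℂ} (hz : ∀ i, ‖z i‖ < 1) :
    HasSum (fun α : Fin n → ℕ => ‖∏ i, z i ^ α i‖ ^ 2) (∏ i, (1 - ‖z i‖ ^ 2)⁻¹) := by
  have h := (hasSum_prod_pow (y := fun i => ((‖z i‖ ^ 2 : ℝ) : ℂ)) fun i => by
    rw [norm_real, Real.norm_of_nonneg (by positivity)]
    nlinarith [hz i, norm_nonneg (z i)]).2
  rw [← Complex.hasSum_ofReal]
  convert h using 1
  · ext α; push_cast [norm_prod, norm_pow]; rw [← Finset.prod_pow]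
    exact Finset.prod_congr rfl fun i _ => by ring
  · push_cast; rfl

lemma memℓp_prod_pow {n : ℕ} {z : Fin n → ℂ} (hz : ∀ i, ‖z i‖ < 1) :
    Memℓp (fun α : Fin n → ℕ => ∏ i, z i ^ α i) 2 := by
  refine memℓp_gen ?_
  simpa using (hasSum_norm_prod_pow_sq hz).summable

/-- The reproducing kernel of `H²(𝔻^n)` at the complex conjugate of `z`. -/
def conjKernel {n : ℕ} {z : Fin n → ℂ} (hz : ∀ i, ‖z i‖ < 1) : H2poly n :=
  ⟨fun α => ∏ i, z i ^ α i, memℓp_prod_pow hz⟩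

lemma norm_conj_lt_one {n : ℕ} {z : Fin n → ℂ} (hz : ∀ i, ‖z i‖ < 1) (i : Fin n) :
    ‖(starRingEnd ℂ) (z i)‖ < 1 := by simpa using hz i

/-- The reproducing kernel of `H²(𝔻^n)` at `z`. -/
def kernel {n : ℕ} {z : Fin n → ℂ} (hz : ∀ i, ‖z i‖ < 1) : H2poly n :=
  conjKernel (z := fun i => (starRingEnd ℂ) (z i)) (norm_conj_lt_one hz)

lemma kernel_apply {n : ℕ} {z : Fin n → ℂ} (hz : ∀ i, ‖z i‖ < 1) (α : Fin n → ℕ) :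
    kernel hz α = ∏ i, (starRingEnd ℂ) (z i) ^ α i := rfl

lemma hasSum_eval {n : ℕ} (a : H2poly n) {z : Fin n → ℂ} (hz : ∀ i, ‖z i‖ < 1) :
    HasSum (fun α => a α * ∏ i, z i ^ α i) (inner ℂ (kernel hz) a) := by
  have h : (fun α => a α * ∏ i, z i ^ α i) = fun α => inner ℂ (kernel hz α) (a α) := by
    ext α
    simp [kernel_apply, map_prod]
  rw [h]
  exact lp.hasSum_inner (𝕜 := ℂ) (kernel hz) a

lemma eval_eq_inner {n : ℕ} (a : H2poly n) {z : Fin n → ℂ} (hz : ∀ i, ‖z i‖ < 1) :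
    H2poly.eval a z = inner ℂ (kernel hz) a :=
  (hasSum_eval a hz).tsum_eq

lemma norm_kernel_sq {n : ℕ} {z : Fin n → ℂ} (hz : ∀ i, ‖z i‖ < 1) :
    ‖kernel hz‖ ^ 2 = ∏ i, (1 - ‖z i‖ ^ 2)⁻¹ := by
  have h := lp.norm_rpow_eq_tsum (p := 2) (by norm_num) (kernel hz)
  have h2 := (hasSum_norm_prod_pow_sq (norm_conj_lt_one hz)).tsum_eq
  simp only [RCLike.norm_conj] at h2
  simp only [ENNReal.toReal_ofNat, Real.rpow_ofNat, kernel_apply] at h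
  rw [h, h2]

lemma tendsto_inner_of_tendsto_apply {ι : Type*} {f : ℕ → lp (fun _ : ι => ℂ) 2}
    (hf : ∀ n, ‖f n‖ ≤ 1) (h0 : ∀ α, Tendsto (fun n => f n α) atTop (𝓝 0))
    (h : lp (fun _ : ι => ℂ) 2) : Tendsto (fun n => inner ℂ h (f n)) atTop (𝓝 0) := by
  classical
  rw [Metric.tendsto_atTop']
  intro ε hε
  obtain ⟨s, hs⟩ := (Metric.tendsto_nhds.1 (lp.hasSum_single (by simp) h) (ε / 2)
    (by positivity)).exists
  have h1 : Tendsto (fun n => inner ℂ (∑ i ∈ s, lp.single 2 i (h i)) (f n)) atTop (𝓝 0) := by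
    simp only [sum_inner, lp.inner_single_left]
    have h2 := tendsto_finsetSum s fun i _ =>
      (tendsto_const_nhds (x := h i)).inner (𝕜 := ℂ) (h0 i)
    simpa only [inner_zero_right, Finset.sum_const_zero] using h2
  obtain ⟨M, hM⟩ := (Metric.tendsto_atTop'.1 h1) (ε / 2) (by positivity)
  refine ⟨M, fun n hn => ?_⟩
  have h2 := hM n hn
  rw [dist_zero_right] at h2 ⊢
  have h3 : inner ℂ h (f n) = inner ℂ (∑ i ∈ s, lp.single 2 i (h i)) (f n) -
      inner ℂ (∑ i ∈ s, lp.single 2 i (h i) - h) (f n) := by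
    rw [inner_sub_left]; ring
  have h4 := norm_inner_le_norm (𝕜 := ℂ) (∑ i ∈ s, lp.single 2 i (h i) - h) (f n)
  rw [dist_eq_norm] at hs
  rw [h3]
  refine (norm_sub_le _ _).trans_lt ?_
  have h5 := mul_le_mul_of_nonneg_left (hf n) (norm_nonneg (∑ i ∈ s, lp.single 2 i (h i) - h))
  linarith

lemma not_isCompactOperator_of_tendsto_apply {ι κ : Type*}
    (T : lp (fun _ : ι => ℂ) 2 →L[ℂ] lp (fun _ : κ => ℂ) 2) {f : ℕ → lp (fun _ : ι => ℂ) 2}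
    (hf : ∀ n, ‖f n‖ ≤ 1) (h0 : ∀ α, Tendsto (fun n => f n α) atTop (𝓝 0))
    {c : ℝ} (hc : 0 < c) (hT : ∀ n, c ≤ ‖T (f n)‖) : ¬ IsCompactOperator T := by
  intro hcomp
  have hK := IsCompactOperator.isCompact_closure_image_closedBall
    (f := T.toLinearMap) (by exact hcomp) 1
  obtain ⟨g, -, φ, hφ, hg⟩ := hK.tendsto_subseq (x := fun n => T (f n)) fun n =>
    subset_closure ⟨f n, by simpa using hf n, rfl⟩
  have h1 : Tendsto (fun n => inner ℂ g (T (f (φ n)))) atTop (𝓝 0) := by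
    simp only [← ContinuousLinearMap.adjoint_inner_left]
    exact tendsto_inner_of_tendsto_apply (fun n => hf _)
      (fun α => (h0 α).comp hφ.tendsto_atTop) _
  have h2 : g = 0 := by
    rw [← inner_self_eq_zero (𝕜 := ℂ)]
    exact tendsto_nhds_unique ((tendsto_const_nhds (x := g)).inner (𝕜 := ℂ) hg) h1
  have h3 := ge_of_tendsto' hg.norm fun n => hT (φ n)
  rw [h2, norm_zero] at h3
  linarith

lemma not_isCompactOperator_of_isCompOpPoly_lens {N : ℕ} (hN : 2 ≤ N) (i₀ : Fin N)
    {T : H2poly N →L[ℂ] H2poly N}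
    (hT : IsCompOpPoly (fun z _ => lens (1 / (N : ℝ)) (z i₀)) T) :
    ¬ IsCompactOperator ⇑T := by
  have hN2 : (2 : ℝ) ≤ N := by exact_mod_cast hN
  have hθ0 : 0 < 1 / (N : ℝ) := by positivity
  have hθ1 : 1 / (N : ℝ) ≤ 1 / 2 := by gcongr
  set r : ℕ → ℝ := fun n => 1 - 1 / ((n : ℝ) + 1) with hr
  have hr0 : ∀ n, 0 ≤ r n := fun n => by
    simp only [hr, sub_nonneg]; rw [div_le_one (by positivity)]; linarith [n.cast_nonneg (α := ℝ)]
  have hr1 : ∀ n, r n < 1 := fun n => by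
    simp only [hr]; linarith [Nat.one_div_pos_of_nat (α := ℝ) (n := n)]
  have hrn : ∀ n, ‖(r n : ℂ)‖ < 1 := fun n => by
    rw [norm_real, Real.norm_of_nonneg (hr0 n)]; exact hr1 n
  have hw : ∀ n (_ : Fin N), ‖lens (1 / (N : ℝ)) (r n)‖ < 1 := fun n _ =>
    norm_lens_lt_one hθ0 hθ1 (hrn n)
  have hz : ∀ n (i : Fin N), ‖(Pi.single i₀ (r n : ℂ) : Fin N → ℂ) i‖ < 1 := by
    intro n i
    rw [Pi.single_apply]
    split_ifs
    · exact hrn n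
    · simp
  have hkz : ∀ n, ‖kernel (hz n)‖ ^ 2 = (1 - r n ^ 2)⁻¹ := fun n => by
    rw [norm_kernel_sq, Finset.prod_eq_single i₀]
    · simp
    · intro i _ hi; simp [hi]
    · simp
  have hkw : ∀ n, (1 - r n ^ 2)⁻¹ / 4 ^ N ≤ ‖kernel (hw n)‖ ^ 2 := fun n => by
    rw [norm_kernel_sq, Finset.prod_const, Finset.card_univ, Fintype.card_fin, div_eq_mul_inv,
      ← mul_inv, inv_pow, mul_comm]
    refine inv_anti₀ (pow_pos ?_ _) (one_sub_norm_lens_sq_pow_le hN (hr0 n) (hr1 n))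
    have := hw n i₀
    nlinarith [norm_nonneg (lens (1 / (N : ℝ)) (r n))]
  have hsq : ∀ n, 0 < 1 - r n ^ 2 := fun n => by nlinarith [hr0 n, hr1 n]
  have hkw0 : ∀ n, 0 < ‖kernel (hw n)‖ := fun n => by
    have : 0 < ‖kernel (hw n)‖ ^ 2 := lt_of_lt_of_le (by have := hsq n; positivity) (hkw n)
    exact lt_of_pow_lt_pow_left₀ 2 (norm_nonneg _) (by simpa using this)
  have hinv : Tendsto (fun n => ‖kernel (hw n)‖⁻¹) atTop (𝓝 0) := by
    have h1 : Tendsto (fun n => 4 ^ N * (1 - r n ^ 2)) atTop (𝓝 0) := by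
      have h2 : Tendsto r atTop (𝓝 (1 - 0)) :=
        tendsto_const_nhds.sub tendsto_one_div_add_atTop_nhds_zero_nat
      simpa using ((tendsto_const_nhds (x := (1 : ℝ))).sub (h2.pow 2)).const_mul (4 ^ N)
    have h3 : Tendsto (fun n => (‖kernel (hw n)‖⁻¹) ^ 2) atTop (𝓝 0) := by
      refine squeeze_zero (fun n => by positivity) (fun n => ?_) h1
      rw [inv_pow]
      refine inv_le_of_inv_le₀ (by have := hsq n; positivity) ?_
      rw [mul_inv, mul_comm, ← div_eq_mul_inv]
      exact hkw n
    have h4 := h3.sqrt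
    simpa [Real.sqrt_sq] using h4
  refine not_isCompactOperator_of_tendsto_apply T
    (f := fun n => ((‖kernel (hw n)‖⁻¹ : ℝ) : ℂ) • kernel (hw n)) (c := (2 ^ N)⁻¹)
    (fun n => ?_) (fun α => ?_) (by positivity) fun n => ?_
  · rw [norm_smul, norm_real, norm_inv, norm_norm, inv_mul_cancel₀ (hkw0 n).ne']
  · refine squeeze_zero_norm (fun n => ?_) hinv
    rw [lp.coeFn_smul, Pi.smul_apply, norm_smul, norm_real, norm_inv, norm_norm, kernel_apply,
      norm_prod]
    refine mul_le_of_le_one_right (by positivity) (Finset.prod_le_one (by simp) fun i _ => ?_)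
    rw [norm_pow]
    exact pow_le_one₀ (norm_nonneg _) (norm_conj_lt_one (hw n) i).le
  · have h1 := hT (((‖kernel (hw n)‖⁻¹ : ℝ) : ℂ) • kernel (hw n))
      (Pi.single i₀ (r n : ℂ)) (hz n)
    simp only [Pi.single_eq_same] at h1
    rw [eval_eq_inner _ (hz n), eval_eq_inner _ (hw n), inner_smul_right,
      inner_self_eq_norm_sq_to_K] at h1
    have h2 := norm_inner_le_norm (𝕜 := ℂ) (kernel (hz n))
      (T (((‖kernel (hw n)‖⁻¹ : ℝ) : ℂ) • kernel (hw n)))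
    rw [h1] at h2
    generalize ‖T (((‖kernel (hw n)‖⁻¹ : ℝ) : ℂ) • kernel (hw n))‖ = t at h2 ⊢
    have h3 := hkw n
    rw [← hkz n] at h3
    have h4 := hkw0 n
    have h5 : 0 < ‖kernel (hz n)‖ := by
      have := hkz n ▸ inv_pos.2 (hsq n)
      exact lt_of_pow_lt_pow_left₀ 2 (norm_nonneg _) (by simpa using this)
    generalize ‖kernel (hw n)‖ = u at *
    generalize ‖kernel (hz n)‖ = v at *
    have h6 : ‖((u⁻¹ : ℝ) : ℂ) * (u : ℂ) ^ 2‖ = u := by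
      rw [← ofReal_pow, ← ofReal_mul, norm_real, Real.norm_of_nonneg (by positivity)]
      field_simp
    have h7 : v / 2 ^ N ≤ u := by
      refine le_of_sq_le_sq ?_ h4.le
      rw [div_pow, ← pow_mul, mul_comm N, pow_mul]; norm_num; exact h3
    have h8 : u ≤ v * t := h6 ▸ h2
    have h9 : v * (2 ^ N)⁻¹ ≤ v * t := h7.trans h8
    exact le_of_mul_le_mul_left h9 h5

lemma lintegral_exp_neg_mul_abs_sub_rpow {p b : ℝ} (hp : 0 < p) (hb : 0 < b) (x : ℝ) :
    ∫⁻ t, ENNReal.ofReal (Real.exp (-b * |t - x| ^ p)) =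
      ENNReal.ofReal (2 * (b ^ (-1 / p) * Real.Gamma (1 / p + 1))) := by
  rw [lintegral_sub_right_eq_self fun t => ENNReal.ofReal (Real.exp (-b * |t| ^ p))]
  have h := integral_comp_abs (f := fun t => Real.exp (-b * t ^ p))
  rw [integral_exp_neg_mul_rpow hp hb] at h
  have hpos : 0 < 2 * (b ^ (-1 / p) * Real.Gamma (1 / p + 1)) := by
    have := Real.Gamma_pos_of_pos (s := 1 / p + 1) (by positivity)
    positivity
  rw [← h, ofReal_integral_eq_lintegral_ofReal]
  · by_contra hni
    rw [integral_undef hni] at h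
    exact hpos.ne h
  · exact ae_of_all _ fun t => (Real.exp_pos _).le

lemma abs_sin_le_norm_one_sub_sq (r x : ℝ) :
    |Real.sin (2 * x)| ≤ ‖1 - ((r : ℂ) * exp (x * I)) ^ 2‖ := by
  have h : ‖1 - ((r : ℂ) * exp (x * I)) ^ 2‖ ^ 2 =
      (1 - r ^ 2 * Real.cos (2 * x)) ^ 2 + (r ^ 2 * Real.sin (2 * x)) ^ 2 := by
    rw [mul_pow, ← Complex.exp_nat_mul, ← normSq_eq_norm_sq, normSq_apply,
      show ((2 : ℕ) : ℂ) * (x * I) = ((2 * x : ℝ) : ℂ) * I by push_cast; ring, exp_mul_I,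
      ← ofReal_cos, ← ofReal_sin, ← ofReal_pow]
    generalize Real.cos (2 * x) = c
    generalize Real.sin (2 * x) = s
    generalize r ^ 2 = q
    simp
    ring
  refine abs_le_of_sq_le_sq (le_of_le_of_eq ?_ h.symm) (norm_nonneg _)
  nlinarith [Real.sin_sq_add_cos_sq (2 * x), sq_nonneg (r ^ 2 - Real.cos (2 * x))]

lemma exists_abs_sub_le_abs_sin {t : ℝ} (ht : t ∈ Ioc (0 : ℝ) 1) :
    ∃ j ∈ Finset.range 5, |t - j / 4| ≤ |Real.sin (4 * Real.pi * t)| := by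
  have h0 : 0 ≤ round (4 * t) := by
    rw [round_eq, Int.floor_nonneg]; linarith [ht.1]
  have h4 : round (4 * t) < 5 := by
    rw [round_eq, Int.floor_lt]; push_cast; linarith [ht.2]
  have hr := abs_sub_round (4 * t)
  obtain ⟨j, hj⟩ := Int.eq_ofNat_of_zero_le h0
  rw [hj] at hr h4
  refine ⟨j, Finset.mem_range.2 (by exact_mod_cast h4), ?_⟩
  push_cast at hr
  have h1 : |Real.sin (4 * Real.pi * t)| = |Real.sin (4 * Real.pi * (t - j / 4))| := by
    rw [show 4 * Real.pi * (t - j / 4) = 4 * Real.pi * t - j * Real.pi by ring,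
      Real.sin_sub_nat_mul_pi, abs_mul, abs_pow, abs_neg, abs_one, one_pow, one_mul]
  have h2 : |4 * Real.pi * (t - j / 4)| = Real.pi * |4 * t - j| := by
    rw [show 4 * Real.pi * (t - j / 4) = Real.pi * (4 * t - j) by ring, abs_mul,
      abs_of_pos Real.pi_pos]
  have h3 := Real.mul_abs_le_abs_sin (x := 4 * Real.pi * (t - j / 4))
    (by rw [h2]; nlinarith [Real.pi_pos])
  have h5 : |4 * t - j| = 4 * |t - j / 4| := by
    rw [show 4 * t - (j : ℝ) = 4 * (t - j / 4) by ring, abs_mul,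
      abs_of_pos (by norm_num : (0 : ℝ) < 4)]
  rw [h1]
  refine le_trans ?_ h3
  rw [h2, h5]
  have : 2 / Real.pi * (Real.pi * (4 * |t - j / 4|)) = 8 * |t - j / 4| := by
    field_simp; ring
  rw [this]
  linarith [abs_nonneg (t - (j : ℝ) / 4)]

lemma norm_lens_pow_le_sum {θ : ℝ} (h0 : 0 < θ) (h1 : θ ≤ 1 / 2) {r : ℝ} (hr0 : 0 ≤ r)
    (hr1 : r < 1) {t : ℝ} (ht : t ∈ Ioc (0 : ℝ) 1) (k : ℕ) :
    ‖lens θ (r * exp ((2 * Real.pi * t : ℝ) * I))‖ ^ k ≤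
      ∑ j ∈ Finset.range 5, Real.exp 1 * Real.exp (-((k + 1) / 16) * |t - j / 4| ^ θ) := by
  set z : ℂ := r * exp ((2 * Real.pi * t : ℝ) * I) with hzdef
  have hz : ‖z‖ < 1 := by
    rw [hzdef, norm_mul, norm_exp_ofReal_mul_I, mul_one, norm_real, Real.norm_of_nonneg hr0]
    exact hr1
  obtain ⟨j, hj, hle⟩ := exists_abs_sub_le_abs_sin ht
  have hy : |t - j / 4| ≤ ‖1 - z ^ 2‖ := hle.trans (by
    have := abs_sin_le_norm_one_sub_sq r (2 * Real.pi * t)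
    rwa [show 2 * (2 * Real.pi * t) = 4 * Real.pi * t by ring] at this)
  have hy2 : ‖1 - z ^ 2‖ ^ θ ≤ 2 := by
    have h2 : ‖1 - z ^ 2‖ ≤ 2 := by
      refine (norm_sub_le _ _).trans ?_
      rw [norm_one, norm_pow]
      nlinarith [norm_nonneg z]
    calc ‖1 - z ^ 2‖ ^ θ ≤ 2 ^ θ := by gcongr
      _ ≤ 2 ^ (1 : ℝ) := Real.rpow_le_rpow_of_exponent_le one_le_two (by linarith)
      _ = 2 := Real.rpow_one 2
  have hyp : |t - j / 4| ^ θ ≤ ‖1 - z ^ 2‖ ^ θ := by gcongr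
  refine le_trans ?_ (Finset.single_le_sum (f := fun j : ℕ =>
    Real.exp 1 * Real.exp (-((k + 1) / 16) * |t - j / 4| ^ θ)) (fun j _ => by positivity) hj)
  calc ‖lens θ z‖ ^ k ≤ Real.exp (-(‖1 - z ^ 2‖ ^ θ / 16)) ^ k := by
        gcongr; exact norm_lens_le_exp h0 h1 hz
    _ ≤ Real.exp 1 * Real.exp (-((k + 1) / 16) * |t - j / 4| ^ θ) := by
        rw [← Real.exp_nat_mul, ← Real.exp_add, Real.exp_le_exp]
        have hk : (0 : ℝ) ≤ k := k.cast_nonneg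
        nlinarith [mul_le_mul_of_nonneg_left hyp hk]

lemma lintegral_enorm_lens_pow_le {N : ℕ} (hN : 2 ≤ N) : ∃ C : ℝ≥0∞, C ≠ ⊤ ∧
    ∀ (r : ℝ), 0 ≤ r → r < 1 → ∀ k : ℕ,
      ∫⁻ t in Ioc (0 : ℝ) 1, ‖lens (1 / (N : ℝ)) (r * exp ((2 * Real.pi * t : ℝ) * I))‖ₑ ^ k ≤
        C * ((k + 1 : ℝ≥0∞) ^ N)⁻¹ := by
  have hN2 : (2 : ℝ) ≤ N := by exact_mod_cast hN
  have hθ0 : 0 < 1 / (N : ℝ) := by positivity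
  have hθ1 : 1 / (N : ℝ) ≤ 1 / 2 := by gcongr
  refine ⟨5 * (ENNReal.ofReal (Real.exp 1) * ENNReal.ofReal (2 * (16 ^ N * Real.Gamma (N + 1)))),
    by finiteness, fun r hr0 hr1 k => ?_⟩
  have hb : (0 : ℝ) < (k + 1) / 16 := by positivity
  calc ∫⁻ t in Ioc (0 : ℝ) 1, ‖lens (1 / (N : ℝ)) (r * exp ((2 * Real.pi * t : ℝ) * I))‖ₑ ^ k
      ≤ ∫⁻ t in Ioc (0 : ℝ) 1, ∑ j ∈ Finset.range 5, ENNReal.ofReal (Real.exp 1) *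
          ENNReal.ofReal (Real.exp (-((k + 1) / 16) * |t - j / 4| ^ (1 / (N : ℝ)))) := by
        refine setLIntegral_mono' measurableSet_Ioc fun t ht => ?_
        simp_rw [← ENNReal.ofReal_mul (Real.exp_pos 1).le]
        rw [← ENNReal.ofReal_sum_of_nonneg fun j _ => by positivity, ← ofReal_norm,
          ← ENNReal.ofReal_pow (norm_nonneg _)]
        exact ENNReal.ofReal_le_ofReal (norm_lens_pow_le_sum hθ0 hθ1 hr0 hr1 ht k)
    _ ≤ ∫⁻ t : ℝ, ∑ j ∈ Finset.range 5, ENNReal.ofReal (Real.exp 1) *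
          ENNReal.ofReal (Real.exp (-((k + 1) / 16) * |t - j / 4| ^ (1 / (N : ℝ)))) :=
        setLIntegral_le_lintegral _ _
    _ = 5 * (ENNReal.ofReal (Real.exp 1) * ENNReal.ofReal
          (2 * (((k + 1) / 16 : ℝ) ^ (-1 / (1 / (N : ℝ))) *
            Real.Gamma (1 / (1 / (N : ℝ)) + 1)))) := by
        rw [lintegral_finsetSum _ fun j _ => by fun_prop]
        simp_rw [lintegral_const_mul' _ _ ENNReal.ofReal_ne_top,
          lintegral_exp_neg_mul_abs_sub_rpow hθ0 hb]
        simp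
    _ = _ := by
        have h1 : ((k + 1) / 16 : ℝ) ^ (-1 / (1 / (N : ℝ))) = 16 ^ N * ((k + 1 : ℝ) ^ N)⁻¹ := by
          rw [show -1 / (1 / (N : ℝ)) = -N by field_simp, Real.rpow_neg (by positivity),
            Real.rpow_natCast, div_pow]
          field_simp
        have h2 : ((k + 1 : ℝ≥0∞) ^ N)⁻¹ = ENNReal.ofReal (((k + 1 : ℝ) ^ N)⁻¹) := by
          rw [ENNReal.ofReal_inv_of_pos (by positivity), ENNReal.ofReal_pow (by positivity),
            ENNReal.ofReal_add (by positivity) zero_le_one]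
          simp
        have hG := Real.Gamma_pos_of_pos (s := N + 1) (by positivity)
        rw [h1, h2, one_div_one_div, show 2 * (16 ^ N * ((k + 1 : ℝ) ^ N)⁻¹ * Real.Gamma (N + 1)) =
          2 * (16 ^ N * Real.Gamma (N + 1)) * ((k + 1 : ℝ) ^ N)⁻¹ by ring,
          ENNReal.ofReal_mul (by positivity)]
        ring

lemma enat_card_sum_eq_le (n m : ℕ) :
    (ENat.card {β : Fin (n + 1) → ℕ // ∑ i, β i = m} : ℝ≥0∞) ≤ (m + 1) ^ n := by
  have hlt : ∀ (β : {β : Fin (n + 1) → ℕ // ∑ i, β i = m}) (i : Fin (n + 1)), β.1 i < m + 1 :=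
    fun β i => Nat.lt_succ_of_le <|
      (Finset.single_le_sum (f := β.1) (by simp) (Finset.mem_univ i)).trans_eq β.2
  let F : {β : Fin (n + 1) → ℕ // ∑ i, β i = m} → (Fin n → Fin (m + 1)) :=
    fun β i => ⟨β.1 i.succ, hlt β i.succ⟩
  have hF : Function.Injective F := by
    rintro ⟨β, hβ⟩ ⟨γ, hγ⟩ h
    have hs : ∀ i : Fin n, β i.succ = γ i.succ := fun i => by
      simpa [F] using congrArg Fin.val (congrFun h i)
    rw [Fin.sum_univ_succ] at hβ hγ
    simp only [hs] at hβ
    ext i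
    refine Fin.cases ?_ hs i
    show β 0 = γ 0
    omega
  have h1 := ENat.card_le_card_of_injective hF
  have h2 : ENat.card (Fin n → Fin (m + 1)) = (((m + 1) ^ n : ℕ) : ℕ∞) := by
    simp
  rw [h2] at h1
  calc (ENat.card {β : Fin (n + 1) → ℕ // ∑ i, β i = m} : ℝ≥0∞)
      ≤ (((((m + 1) ^ n : ℕ) : ℕ∞)) : ℝ≥0∞) := by exact_mod_cast h1
    _ = (m + 1) ^ n := by simp

lemma tsum_comp_sum_le (n : ℕ) (g : ℕ → ℝ≥0∞) :
    ∑' β : Fin (n + 1) → ℕ, g (∑ i, β i) ≤ ∑' m : ℕ, (m + 1) ^ n * g m := by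
  rw [← (Equiv.sigmaFiberEquiv fun β : Fin (n + 1) → ℕ => ∑ i, β i).tsum_eq, ENNReal.tsum_sigma']
  refine ENNReal.tsum_le_tsum fun m => ?_
  calc ∑' b : {β : Fin (n + 1) → ℕ // ∑ i, β i = m},
        g (∑ i, (Equiv.sigmaFiberEquiv fun β : Fin (n + 1) → ℕ => ∑ i, β i) ⟨m, b⟩ i)
      = ∑' b : {β : Fin (n + 1) → ℕ // ∑ i, β i = m}, g m := by
        refine tsum_congr fun b => ?_
        rw [Equiv.sigmaFiberEquiv_apply]
        exact congrArg g b.2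
    _ ≤ _ := by
        rw [ENNReal.tsum_const]
        gcongr
        exact enat_card_sum_eq_le n m

lemma tsum_inv_sq_le (n : ℕ) : ∑' m : ℕ, ((n + m + 1 : ℝ≥0∞) ^ 2)⁻¹ ≤ 2 * (n + 1 : ℝ≥0∞)⁻¹ := by
  have key : ∀ M : ℕ, ∑ m ∈ Finset.range M, ((n + m + 1 : ℝ) ^ 2)⁻¹ ≤
      2 * ((n + 1 : ℝ)⁻¹ - (n + M + 1 : ℝ)⁻¹) := fun M => by
    induction M with
    | zero => simp
    | succ M ih =>
      rw [Finset.sum_range_succ]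
      have : ((n + M + 1 : ℝ) ^ 2)⁻¹ ≤ 2 * ((n + M + 1 : ℝ)⁻¹ - (n + (M + 1) + 1 : ℝ)⁻¹) := by
        rw [inv_sub_inv (by positivity) (by positivity), inv_eq_one_div, mul_div_assoc',
          div_le_div_iff₀ (by positivity) (by positivity)]
        ring_nf
        have : (0 : ℝ) ≤ n := n.cast_nonneg
        have : (0 : ℝ) ≤ M := M.cast_nonneg
        nlinarith [mul_nonneg ‹(0 : ℝ) ≤ n› ‹(0 : ℝ) ≤ M›]
      push_cast
      linarith
  refine ENNReal.tsum_le_of_sum_range_le fun M => ?_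
  have h1 : ∀ x : ℕ, ((n + x + 1 : ℝ≥0∞) ^ 2)⁻¹ = ENNReal.ofReal (((n + x + 1 : ℝ) ^ 2)⁻¹) :=
    fun x => by
    rw [ENNReal.ofReal_inv_of_pos (by positivity), ENNReal.ofReal_pow (by positivity)]
    norm_cast
  have h2 : 2 * (n + 1 : ℝ≥0∞)⁻¹ = ENNReal.ofReal (2 * (n + 1 : ℝ)⁻¹) := by
    rw [ENNReal.ofReal_mul zero_le_two, ENNReal.ofReal_inv_of_pos (by positivity)]
    norm_cast
  simp_rw [h1]
  rw [h2, ← ENNReal.ofReal_sum_of_nonneg fun i _ => by positivity]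
  refine ENNReal.ofReal_le_ofReal ((key M).trans ?_)
  have : (0 : ℝ) ≤ (n + M + 1 : ℝ)⁻¹ := by positivity
  linarith

lemma two_mul_mul_le_sq_mul_div_add (x y : ℝ≥0∞) {p q : ℝ≥0∞} (hp : p ≠ 0) (hp' : p ≠ ⊤)
    (hq : q ≠ 0) (hq' : q ≠ ⊤) : 2 * (x * y) ≤ x ^ 2 * (p / q) + y ^ 2 * (q / p) := by
  rcases eq_or_ne x ⊤ with rfl | hx
  · have : p / q ≠ 0 := ENNReal.div_ne_zero.2 ⟨hp, hq'⟩
    simp [ENNReal.top_mul, this]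
  rcases eq_or_ne y ⊤ with rfl | hy
  · have : q / p ≠ 0 := ENNReal.div_ne_zero.2 ⟨hq, hp'⟩
    simp [ENNReal.top_mul, this]
  lift x to NNReal using hx
  lift y to NNReal using hy
  lift p to NNReal using hp'
  lift q to NNReal using hq'
  have hp0 : p ≠ 0 := by simpa using hp
  have hq0 : q ≠ 0 := by simpa using hq
  rw [← ENNReal.coe_div hp0, ← ENNReal.coe_div hq0]
  norm_cast
  rw [← NNReal.coe_le_coe]
  push_cast
  have h1 : (0 : ℝ) < p := by positivity
  have h2 : (0 : ℝ) < q := by positivity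
  have h3 : (x : ℝ) ^ 2 * (p / q) + y ^ 2 * (q / p) - 2 * (x * y) =
      (x * p - y * q) ^ 2 / (p * q) := by
    field_simp
    ring
  have h4 : (0 : ℝ) ≤ (x * p - y * q) ^ 2 / (p * q) := by positivity
  linarith

lemma tsum_tsum_mul_mul_le_of_schur {ι : Type*} {K : ι → ι → ℝ≥0∞} (hK : ∀ i j, K i j = K j i)
    {p : ι → ℝ≥0∞} (hp : ∀ i, p i ≠ 0) (hp' : ∀ i, p i ≠ ⊤) {C : ℝ≥0∞}
    (hC : ∀ i, ∑' j, p i / p j * K i j ≤ C) (x : ι → ℝ≥0∞) :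
    ∑' i, ∑' j, x i * x j * K i j ≤ C * ∑' i, x i ^ 2 := by
  have h1 : ∑' i, ∑' j, x i ^ 2 * (p i / p j) * K i j ≤ C * ∑' i, x i ^ 2 := by
    rw [← ENNReal.tsum_mul_left]
    refine ENNReal.tsum_le_tsum fun i => ?_
    simp_rw [mul_assoc]
    rw [ENNReal.tsum_mul_left, mul_comm]
    gcongr
    exact hC i
  have h2 : ∑' i, ∑' j, x j ^ 2 * (p j / p i) * K i j ≤ C * ∑' i, x i ^ 2 := by
    rw [ENNReal.tsum_comm]
    exact (tsum_congr fun j => tsum_congr fun i => by rw [hK i j]).trans_le h1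
  have h3 : 2 * ∑' i, ∑' j, x i * x j * K i j ≤ 2 * (C * ∑' i, x i ^ 2) := by
    calc 2 * ∑' i, ∑' j, x i * x j * K i j
        = ∑' i, ∑' j, 2 * (x i * x j) * K i j := by
          simp_rw [← ENNReal.tsum_mul_left, mul_assoc]
      _ ≤ ∑' i, ∑' j, (x i ^ 2 * (p i / p j) * K i j + x j ^ 2 * (p j / p i) * K i j) := by
          refine ENNReal.tsum_le_tsum fun i => ENNReal.tsum_le_tsum fun j => ?_
          rw [← add_mul]
          gcongr
          exact two_mul_mul_le_sq_mul_div_add _ _ (hp i) (hp' i) (hp j) (hp' j)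
      _ = (∑' i, ∑' j, x i ^ 2 * (p i / p j) * K i j) +
            ∑' i, ∑' j, x j ^ 2 * (p j / p i) * K i j := by
          simp_rw [ENNReal.tsum_add]
      _ ≤ _ := by rw [two_mul]; exact add_le_add h1 h2
  exact (ENNReal.mul_le_mul_iff_right two_ne_zero ENNReal.ofNat_ne_top).1 h3

lemma hilbert_inequality_multi {N : ℕ} (hN : 2 ≤ N) (x : (Fin N → ℕ) → ℝ≥0∞) :
    ∑' α, ∑' β, x α * x β * (((∑ i, α i + ∑ i, β i : ℕ) + 1 : ℝ≥0∞) ^ N)⁻¹ ≤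
      2 * ∑' α, x α ^ 2 := by
  obtain ⟨n, rfl⟩ : ∃ n, N = n + 2 := ⟨N - 2, by omega⟩
  refine tsum_tsum_mul_mul_le_of_schur
    (K := fun α β : Fin (n + 2) → ℕ =>
      (((∑ i, α i + ∑ i, β i : ℕ) + 1 : ℝ≥0∞) ^ (n + 2))⁻¹)
    (p := fun α => ((∑ i, α i : ℕ) : ℝ≥0∞) + 1)
    (fun α β => by rw [add_comm (∑ i, α i)]) (fun _ => by simp) (fun _ => by finiteness)
    (fun α => ?_) x
  set a := ∑ i, α i
  refine (tsum_comp_sum_le (n + 1) fun m =>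
    ((a : ℝ≥0∞) + 1) / (m + 1) * (((a + m : ℕ) + 1 : ℝ≥0∞) ^ (n + 2))⁻¹).trans ?_
  calc ∑' m : ℕ, ((m : ℝ≥0∞) + 1) ^ (n + 1) *
        (((a : ℝ≥0∞) + 1) / (m + 1) * (((a + m : ℕ) + 1 : ℝ≥0∞) ^ (n + 2))⁻¹)
      ≤ ∑' m : ℕ, ((a : ℝ≥0∞) + 1) * ((a + m + 1 : ℝ≥0∞) ^ 2)⁻¹ := by
        refine ENNReal.tsum_le_tsum fun m => ?_
        have h0 : ((m : ℝ≥0∞) + 1) ≠ 0 := by simp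
        have h0' : ((m : ℝ≥0∞) + 1) ≠ ⊤ := by finiteness
        have h1 : (((a + m : ℕ) + 1 : ℝ≥0∞) ^ (n + 2))⁻¹ ≤
            ((m + 1 : ℝ≥0∞) ^ n)⁻¹ * ((a + m + 1 : ℝ≥0∞) ^ 2)⁻¹ := by
          rw [← ENNReal.mul_inv (Or.inr (by finiteness)) (Or.inl (by finiteness)), pow_add]
          push_cast
          gcongr
          exact le_add_self
        calc _ ≤ ((m : ℝ≥0∞) + 1) ^ (n + 1) * (((a : ℝ≥0∞) + 1) / (m + 1) *
              (((m + 1 : ℝ≥0∞) ^ n)⁻¹ * ((a + m + 1 : ℝ≥0∞) ^ 2)⁻¹)) := by gcongr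
          _ = (((m : ℝ≥0∞) + 1) ^ n * ((m + 1 : ℝ≥0∞) ^ n)⁻¹) *
                (((m : ℝ≥0∞) + 1) * ((m : ℝ≥0∞) + 1)⁻¹) *
                (((a : ℝ≥0∞) + 1) * ((a + m + 1 : ℝ≥0∞) ^ 2)⁻¹) := by
              rw [div_eq_mul_inv]; ring
          _ = _ := by
              rw [ENNReal.mul_inv_cancel (pow_ne_zero _ h0) (by finiteness),
                ENNReal.mul_inv_cancel h0 h0', one_mul, one_mul]
    _ ≤ ((a : ℝ≥0∞) + 1) * (2 * ((a : ℝ≥0∞) + 1)⁻¹) := by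
        rw [ENNReal.tsum_mul_left]
        gcongr
        exact tsum_inv_sq_le a
    _ = 2 := by
        rw [mul_left_comm, ENNReal.mul_inv_cancel (by simp) (by finiteness), mul_one]

lemma Orthonormal.inner_right_hasSum {ι E : Type*} [NormedAddCommGroup E] [InnerProductSpace ℂ E]
    {v : ι → E} (hv : Orthonormal ℂ v) {a : ι → ℂ} {x : E}
    (hx : HasSum (fun i => a i • v i) x) (i : ι) : inner ℂ (v i) x = a i := by
  classical
  have h := hx.mapL (innerSL ℂ (v i))
  simp only [innerSL_apply_apply, inner_smul_right, orthonormal_iff_ite.1 hv] at h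
  have h1 := hasSum_single (f := fun j => a j * if i = j then (1 : ℂ) else 0) i fun j hj => by
    simp [hj.symm]
  simpa using h.unique h1

lemma sum_norm_taylorCoeff_sq_le {F : ℂ → ℂ} (hF : DifferentiableOn ℂ F (Metric.ball 0 1)) {r : ℝ}
    (hr0 : 0 ≤ r) (hr1 : r < 1) (s : Finset ℕ) :
    ENNReal.ofReal (∑ n ∈ s, (‖(n.factorial : ℂ)⁻¹ * iteratedDeriv n F 0‖ * r ^ n) ^ 2) ≤
      ∫⁻ t in Ioc (0 : ℝ) 1, ‖F (r * exp ((2 * Real.pi * t : ℝ) * I))‖ₑ ^ 2 := by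
  set c : ℕ → ℂ := fun n => (n.factorial : ℂ)⁻¹ * iteratedDeriv n F 0 with hc
  have htaylor : ∀ z : ℂ, ‖z‖ < 1 → HasSum (fun n => c n * z ^ n) (F z) := fun z hz => by
    have h := Complex.hasSum_taylorSeries_on_ball hF (z := z) (by simpa using hz)
    have h1 : (fun n => c n * z ^ n) =
        fun n => (n.factorial : ℂ)⁻¹ • (z - 0) ^ n • iteratedDeriv n F 0 := by
      ext n
      simp only [hc, sub_zero, smul_eq_mul]
      ring
    rwa [h1]
  have hr : ‖(r : ℂ)‖ < 1 := by rwa [norm_real, Real.norm_of_nonneg hr0]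
  have hsum : Summable fun n : ℕ => (c n * (r : ℂ) ^ n) • (fourier (T := 1) (n : ℤ)) := by
    refine Summable.of_norm ?_
    simp_rw [norm_smul, fourier_norm, mul_one]
    exact (htaylor r hr).summable.norm
  obtain ⟨g, hg⟩ := hsum
  have hgF : ∀ t : ℝ, g (t : UnitAddCircle) = F (r * exp ((2 * Real.pi * t : ℝ) * I)) := fun t => by
    have h1 := hg.mapL (ContinuousMap.evalCLM ℂ (t : UnitAddCircle))
    refine h1.unique ?_
    convert htaylor (r * exp ((2 * Real.pi * t : ℝ) * I)) ?_ using 2 with n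
    · simp only [ContinuousMap.evalCLM_apply, ContinuousMap.smul_apply, smul_eq_mul,
        fourier_coe_apply]
      rw [mul_pow, ← Complex.exp_nat_mul, mul_assoc]
      congr 3
      push_cast
      ring
    · rwa [norm_mul, norm_exp_ofReal_mul_I, mul_one]
  have hG := hg.mapL (ContinuousMap.toLp (E := ℂ) 2 (AddCircle.haarAddCircle (T := 1)) ℂ)
  simp only [map_smul] at hG
  have horth : Orthonormal ℂ fun n : ℕ => fourierLp (T := 1) 2 (n : ℤ) :=
    orthonormal_fourier.comp _ Nat.cast_injective
  have hbessel := horth.sum_inner_products_le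
    (x := ContinuousMap.toLp (E := ℂ) 2 (AddCircle.haarAddCircle (T := 1)) ℂ g) (s := s)
  simp only [Orthonormal.inner_right_hasSum horth hG] at hbessel
  have hnorm : ENNReal.ofReal
      (‖ContinuousMap.toLp (E := ℂ) 2 (AddCircle.haarAddCircle (T := 1)) ℂ g‖ ^ 2) =
      ∫⁻ t in Ioc (0 : ℝ) 1, ‖F (r * exp ((2 * Real.pi * t : ℝ) * I))‖ₑ ^ 2 := by
    rw [ENNReal.ofReal_pow (norm_nonneg _), ofReal_norm, Lp.enorm_def,
      eLpNorm_congr_ae (ContinuousMap.coeFn_toLp _ g),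
      eLpNorm_eq_lintegral_rpow_enorm_toReal two_ne_zero ENNReal.ofNat_ne_top]
    simp only [ENNReal.toReal_ofNat, ENNReal.rpow_ofNat]
    rw [← ENNReal.rpow_natCast, ← ENNReal.rpow_mul]
    norm_num
    have hv : (AddCircle.haarAddCircle (T := 1)) = volume := by
      rw [AddCircle.volume_eq_smul_haarAddCircle]; simp
    rw [hv]
    have h1 := UnitAddCircle.lintegral_preimage 0 fun x => ‖g x‖ₑ ^ 2
    rw [zero_add] at h1
    refine h1.symm.trans ?_
    simp_rw [hgF]
    norm_num
  rw [← hnorm]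
  refine ENNReal.ofReal_le_ofReal (le_of_eq_of_le ?_ hbessel)
  refine Finset.sum_congr rfl fun n _ => ?_
  rw [norm_mul (c n), norm_pow, norm_real, Real.norm_of_nonneg hr0]

lemma differentiableOn_eval_diag {N : ℕ} (a : H2poly N) :
    DifferentiableOn ℂ (fun w : ℂ => H2poly.eval a fun _ => w) (Metric.ball 0 1) := by
  intro w hw
  obtain ⟨R, hwR, hR1⟩ := exists_between (mem_ball_zero_iff.1 hw)
  have hR0 : 0 ≤ R := (norm_nonneg w).trans hwR.le
  have hR : ∀ _ : Fin N, ‖(R : ℂ)‖ < 1 := fun _ => by rwa [norm_real, Real.norm_of_nonneg hR0]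
  have hd : DifferentiableOn ℂ (fun w : ℂ => ∑' α : Fin N → ℕ, a α * ∏ i, w ^ α i)
      (Metric.ball 0 R) := by
    refine differentiableOn_tsum_of_summable_norm (hasSum_eval a hR).summable.norm
      (fun α => by fun_prop) Metric.isOpen_ball fun α w hw => ?_
    rw [norm_mul, norm_mul, norm_prod, norm_prod]
    gcongr with i
    rw [norm_pow, norm_pow, norm_real, Real.norm_of_nonneg hR0]
    gcongr
    exact (mem_ball_zero_iff.1 hw).le
  exact (hd.differentiableAt
    (Metric.isOpen_ball.mem_nhds (by simpa using hwR))).differentiableWithinAt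

lemma enorm_eval_diag_sq_le {N : ℕ} (a : H2poly N) (w : ℂ) :
    ‖H2poly.eval a fun _ => w‖ₑ ^ 2 ≤
      ∑' α, ∑' β, ‖a α‖ₑ * ‖a β‖ₑ * ‖w‖ₑ ^ (∑ i, α i + ∑ i, β i) := by
  have h : ‖H2poly.eval a fun _ => w‖ₑ ≤ ∑' α, ‖a α‖ₑ * ‖w‖ₑ ^ (∑ i, α i) := by
    refine enorm_tsum_le_tsum_enorm.trans_eq (tsum_congr fun α => ?_)
    rw [Finset.prod_pow_eq_pow_sum, enorm_mul, enorm_pow]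
  refine (pow_le_pow_left' h 2).trans_eq ?_
  rw [sq, ← ENNReal.tsum_mul_right]
  refine tsum_congr fun α => ?_
  rw [← ENNReal.tsum_mul_left]
  refine tsum_congr fun β => ?_
  rw [pow_add]
  ring

lemma tsum_enorm_sq {ι : Type*} (a : lp (fun _ : ι => ℂ) 2) :
    ∑' α, ‖a α‖ₑ ^ 2 = ENNReal.ofReal (‖a‖ ^ 2) := by
  have h := lp.norm_rpow_eq_tsum (p := 2) (by norm_num) a
  have hs := (lp.memℓp a).summable (by norm_num)
  simp only [ENNReal.toReal_ofNat, Real.rpow_ofNat] at h hs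
  rw [h, ENNReal.ofReal_tsum_of_nonneg (fun _ => by positivity) hs]
  refine tsum_congr fun α => ?_
  rw [ENNReal.ofReal_pow (norm_nonneg _), ofReal_norm]

lemma measurable_lens (θ : ℝ) : Measurable (lens θ) := by
  unfold lens
  fun_prop

/-- The function `z ↦ f(λ_{1/N}(z), …, λ_{1/N}(z))` associated with `f ∈ H²(𝔻^N)`. -/
def lensComp {N : ℕ} (a : H2poly N) (z : ℂ) : ℂ :=
  H2poly.eval a fun _ => lens (1 / (N : ℝ)) z

/-- The `n`-th Taylor coefficient of `lensComp a` at the origin. -/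
def lensCoeff {N : ℕ} (a : H2poly N) (n : ℕ) : ℂ :=
  (n.factorial : ℂ)⁻¹ * iteratedDeriv n (lensComp a) 0

section

variable {N : ℕ}

lemma one_div_natCast_mem (hN : 2 ≤ N) : 0 < 1 / (N : ℝ) ∧ 1 / (N : ℝ) ≤ 1 / 2 := by
  have hN2 : (2 : ℝ) ≤ N := by exact_mod_cast hN
  exact ⟨by positivity, by gcongr⟩

lemma differentiableOn_lensComp (hN : 2 ≤ N) (a : H2poly N) :
    DifferentiableOn ℂ (lensComp a) (Metric.ball 0 1) := by
  obtain ⟨h0, h1⟩ := one_div_natCast_mem hN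
  exact (differentiableOn_eval_diag a).comp (differentiableOn_lens h0 h1) fun z hz =>
    mem_ball_zero_iff.2 (norm_lens_lt_one h0 h1 (mem_ball_zero_iff.1 hz))

lemma hasSum_lensCoeff (hN : 2 ≤ N) (a : H2poly N) {z : ℂ} (hz : ‖z‖ < 1) :
    HasSum (fun n => lensCoeff a n * z ^ n) (lensComp a z) := by
  have h := Complex.hasSum_taylorSeries_on_ball (differentiableOn_lensComp hN a) (z := z)
    (by simpa using hz)
  have h1 : (fun n => lensCoeff a n * z ^ n) =
      fun n => (n.factorial : ℂ)⁻¹ • (z - 0) ^ n • iteratedDeriv n (lensComp a) 0 := by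
    ext n
    simp only [lensCoeff, sub_zero, smul_eq_mul]
    ring
  rwa [h1]

lemma lensCoeff_add (hN : 2 ≤ N) (a b : H2poly N) (n : ℕ) :
    lensCoeff (a + b) n = lensCoeff a n + lensCoeff b n := by
  obtain ⟨h0, h1⟩ := one_div_natCast_mem hN
  have hnhds : Metric.ball (0 : ℂ) 1 ∈ 𝓝 0 := Metric.ball_mem_nhds _ one_pos
  have hcd : ∀ a : H2poly N, ContDiffAt ℂ n (lensComp a) 0 := fun a =>
    ((differentiableOn_lensComp hN a).analyticAt hnhds).contDiffAt
  have heq : lensComp (a + b) =ᶠ[𝓝 0] lensComp a + lensComp b := by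
    filter_upwards [hnhds] with z hz
    have hl : ∀ _ : Fin N, ‖lens (1 / (N : ℝ)) z‖ < 1 := fun _ =>
      norm_lens_lt_one h0 h1 (mem_ball_zero_iff.1 hz)
    simp only [Pi.add_apply, lensComp, eval_eq_inner _ hl, inner_add_right]
  rw [lensCoeff, heq.iteratedDeriv_eq, iteratedDeriv_add (hcd a) (hcd b), mul_add]
  rfl

lemma lensCoeff_smul (hN : 2 ≤ N) (c : ℂ) (a : H2poly N) (n : ℕ) :
    lensCoeff (c • a) n = c * lensCoeff a n := by
  obtain ⟨h0, h1⟩ := one_div_natCast_mem hN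
  have hnhds : Metric.ball (0 : ℂ) 1 ∈ 𝓝 0 := Metric.ball_mem_nhds _ one_pos
  have heq : lensComp (c • a) =ᶠ[𝓝 0] fun z => c * lensComp a z := by
    filter_upwards [hnhds] with z hz
    have hl : ∀ _ : Fin N, ‖lens (1 / (N : ℝ)) z‖ < 1 := fun _ =>
      norm_lens_lt_one h0 h1 (mem_ball_zero_iff.1 hz)
    simp only [lensComp, eval_eq_inner _ hl, inner_smul_right]
  rw [lensCoeff, heq.iteratedDeriv_eq, iteratedDeriv_const_mul_field, lensCoeff]
  ring

lemma exists_sum_norm_lensCoeff_sq_le (hN : 2 ≤ N) : ∃ C : ℝ, 0 ≤ C ∧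
    ∀ (a : H2poly N) (s : Finset ℕ), ∑ n ∈ s, ‖lensCoeff a n‖ ^ 2 ≤ C * ‖a‖ ^ 2 := by
  obtain ⟨C, hC, hle⟩ := lintegral_enorm_lens_pow_le hN
  refine ⟨(C * 2).toReal, ENNReal.toReal_nonneg, fun a s => ?_⟩
  have hr : ∀ r : ℝ, 0 ≤ r → r < 1 →
      ∑ n ∈ s, (‖lensCoeff a n‖ * r ^ n) ^ 2 ≤ (C * 2).toReal * ‖a‖ ^ 2 := by
    intro r hr0 hr1
    rw [← ENNReal.ofReal_le_ofReal_iff (by positivity)]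
    refine (sum_norm_taylorCoeff_sq_le (differentiableOn_lensComp hN a) hr0 hr1 s).trans ?_
    have hmeas : ∀ k : ℕ, Measurable fun t : ℝ =>
        ‖lens (1 / (N : ℝ)) (r * exp ((2 * Real.pi * t : ℝ) * I))‖ₑ ^ k := fun k =>
      (((measurable_lens _).comp (by fun_prop)).enorm).pow_const k
    calc ∫⁻ t in Ioc (0 : ℝ) 1, ‖lensComp a (r * exp ((2 * Real.pi * t : ℝ) * I))‖ₑ ^ 2
        ≤ ∫⁻ t in Ioc (0 : ℝ) 1, ∑' α, ∑' β, ‖a α‖ₑ * ‖a β‖ₑ *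
            ‖lens (1 / (N : ℝ)) (r * exp ((2 * Real.pi * t : ℝ) * I))‖ₑ ^
              (∑ i, α i + ∑ i, β i) := lintegral_mono fun t => enorm_eval_diag_sq_le a _
      _ = ∑' α, ∑' β, ‖a α‖ₑ * ‖a β‖ₑ * ∫⁻ t in Ioc (0 : ℝ) 1,
            ‖lens (1 / (N : ℝ)) (r * exp ((2 * Real.pi * t : ℝ) * I))‖ₑ ^
              (∑ i, α i + ∑ i, β i) := by
          rw [lintegral_tsum fun α => (Measurable.tsum fun β =>
            (hmeas _).const_mul _).aemeasurable]
          refine tsum_congr fun α => ?_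
          rw [lintegral_tsum fun β => ((hmeas _).const_mul _).aemeasurable]
          exact tsum_congr fun β => lintegral_const_mul _ (hmeas _)
      _ ≤ ∑' α, ∑' β, ‖a α‖ₑ * ‖a β‖ₑ *
            (C * (((∑ i, α i + ∑ i, β i : ℕ) + 1 : ℝ≥0∞) ^ N)⁻¹) := by
          refine ENNReal.tsum_le_tsum fun α => ENNReal.tsum_le_tsum fun β => ?_
          gcongr
          exact hle r hr0 hr1 _
      _ = C * ∑' α, ∑' β, ‖a α‖ₑ * ‖a β‖ₑ *
            (((∑ i, α i + ∑ i, β i : ℕ) + 1 : ℝ≥0∞) ^ N)⁻¹ := by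
          simp_rw [← ENNReal.tsum_mul_left, mul_left_comm C]
      _ ≤ C * (2 * ∑' α, ‖a α‖ₑ ^ 2) := by
          gcongr
          exact hilbert_inequality_multi hN _
      _ = ENNReal.ofReal ((C * 2).toReal * ‖a‖ ^ 2) := by
          rw [tsum_enorm_sq, ENNReal.ofReal_mul ENNReal.toReal_nonneg,
            ENNReal.ofReal_toReal (by finiteness), mul_assoc]
  have hcont : Continuous fun r : ℝ => ∑ n ∈ s, (‖lensCoeff a n‖ * r ^ n) ^ 2 := by fun_prop
  have htend := (hcont.tendsto 1).mono_left (nhdsWithin_le_nhds (s := Iio 1))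
  simp only [one_pow, mul_one] at htend
  refine le_of_tendsto htend ?_
  filter_upwards [Ioo_mem_nhdsLT (show (0 : ℝ) < 1 from one_pos)] with r hr'
  exact hr r hr'.1.le hr'.2

end

/-- Extends a sequence to a function on multi-indices supported on the first coordinate axis. -/
def axisExtend {N : ℕ} (i₀ : Fin N) (c : ℕ → ℂ) (α : Fin N → ℕ) : ℂ :=
  if α = Pi.single i₀ (α i₀) then c (α i₀) else 0

lemma sum_norm_axisExtend_sq_le {N : ℕ} (i₀ : Fin N) {c : ℕ → ℂ} {B : ℝ}
    (hc : ∀ s : Finset ℕ, ∑ n ∈ s, ‖c n‖ ^ 2 ≤ B) (s : Finset (Fin N → ℕ)) :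
    ∑ α ∈ s, ‖axisExtend i₀ c α‖ ^ 2 ≤ B := by
  have h : ∀ α : Fin N → ℕ, ‖axisExtend i₀ c α‖ ^ 2 =
      if α = Pi.single i₀ (α i₀) then ‖c (α i₀)‖ ^ 2 else 0 := fun α => by
    unfold axisExtend; split_ifs <;> simp
  simp_rw [h]
  rw [← Finset.sum_filter]
  refine le_of_eq_of_le (Finset.sum_image (f := fun n => ‖c n‖ ^ 2)
    (g := fun α : Fin N → ℕ => α i₀) ?_).symm (hc _)
  intro α hα β hβ hαβ
  simp only [Finset.coe_filter, mem_ofPred_eq] at hα hβ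
  rw [hα.2, hβ.2]
  exact congrArg _ hαβ

lemma tsum_axisExtend_mul {N : ℕ} (i₀ : Fin N) (c : ℕ → ℂ) (z : Fin N → ℂ) :
    ∑' α : Fin N → ℕ, axisExtend i₀ c α * ∏ i, z i ^ α i = ∑' n, c n * z i₀ ^ n := by
  have hinj : Function.Injective fun n : ℕ => (Pi.single i₀ n : Fin N → ℕ) :=
    fun m n h => by simpa using congrFun h i₀
  rw [← hinj.tsum_eq]
  · refine tsum_congr fun n => ?_
    rw [Finset.prod_eq_single i₀ (fun i _ hi => by simp [hi]) (by simp)]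
    simp [axisExtend]
  · intro α hα
    refine ⟨α i₀, ?_⟩
    by_contra h
    exact hα (by simp [axisExtend, Ne.symm h])

lemma exists_isCompOpPoly_lens {N : ℕ} (hN : 2 ≤ N) (i₀ : Fin N) : ∃ T : H2poly N →L[ℂ] H2poly N,
    IsCompOpPoly (fun z _ => lens (1 / (N : ℝ)) (z i₀)) T := by
  obtain ⟨C, hC0, hC⟩ := exists_sum_norm_lensCoeff_sq_le hN
  have hsum := fun a : H2poly N => sum_norm_axisExtend_sq_le i₀ (hC a)
  let L : H2poly N →ₗ[ℂ] H2poly N :=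
    { toFun := fun a => ⟨axisExtend i₀ (lensCoeff a),
        memℓp_gen' (C := C * ‖a‖ ^ 2) fun s => by simpa using hsum a s⟩
      map_add' := fun a b => by
        ext α
        simp only [lp.coeFn_add, Pi.add_apply, axisExtend]
        split_ifs
        · exact lensCoeff_add hN a b _
        · simp
      map_smul' := fun c a => by
        ext α
        simp only [lp.coeFn_smul, Pi.smul_apply, axisExtend, RingHom.id_apply]
        split_ifs
        · exact lensCoeff_smul hN c a _
        · simp }
  refine ⟨L.mkContinuous (Real.sqrt C) fun a => ?_, fun a z hz => ?_⟩
  · refine lp.norm_le_of_forall_sum_le (by norm_num) (by positivity) fun s => ?_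
    have h := hsum a s
    simp only [ENNReal.toReal_ofNat, Real.rpow_ofNat]
    rw [mul_pow, Real.sq_sqrt hC0]
    exact h
  · refine (tsum_axisExtend_mul i₀ (lensCoeff a) z).trans ?_
    exact (hasSum_lensCoeff hN a (hz i₀)).tsum_eq

/-- for `N ≥ 2` and `θ = 1/N`, the composition operator by
`Φ(z₁,…,z_N) = (λ_{1/N}(z₁),…,λ_{1/N}(z₁))` is bounded but not compact on `H²(𝔻^N)`. -/
theorem stmt_8 (N : ℕ) (hN : 2 ≤ N) :
    ∃ T : H2poly N →L[ℂ] H2poly N,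
      IsCompOpPoly (fun z _ => lens (1 / (N : ℝ)) (z ⟨0, by omega⟩)) T ∧
      ¬ IsCompactOperator ⇑T := by
  obtain ⟨T, hT⟩ := exists_isCompOpPoly_lens hN _
  exact ⟨T, hT, not_isCompactOperator_of_isCompOpPoly_lens hN _ hT⟩

end
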